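/- arXiv:2304.12073 — 2 statements merged into one kernel-verified Lean document; each statement's English description precedes it below -/
import Mathlib

section
/- For every complete multipartite graph K_{r_1,…,r_k} whose total number of vertices n = r_1 + … + r_k is odd, the game chromatic number satisfies χ_g(K_{r_1,…,r_k}) ≤ Σ_{i=1}^{k} ⌈r_i/2⌉. -/
/-- A color `c` is legal for vertex `v` in partial coloring `f` if no neighbor of `v`
is already colored with `c`. -/
def legalColor {V C : Type} (G : SimpleGraph V) (f : V → Option C) (v : V) (c : C) : Prop :=
  ∀ w, G.Adj v w → f w ≠ some c

/-- A move in the coloring game: choose an uncolored vertex and color it with a legal color. -/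
def gameMove {V C : Type} [DecidableEq V] (G : SimpleGraph V) (f f' : V → Option C) : Prop :=
  ∃ v c, f v = none ∧ legalColor G f v c ∧ f' = Function.update f v (some c)

/-- Every vertex is colored. -/
def isFull {V C : Type} (f : V → Option C) : Prop := ∀ v, (f v).isSome

/-- Some uncolored vertex has no legal color (then Bob wins). -/
def isStuck {V C : Type} (G : SimpleGraph V) (f : V → Option C) : Prop :=
  ∃ v, f v = none ∧ ∀ c, ¬ legalColor G f v c

/-- It is Alice's turn when an even number of vertices are colored
(Alice moves first, and each move colors exactly one vertex). -/
def aliceTurn {V C : Type} [Fintype V] (f : V → Option C) : Prop :=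
  Even (Finset.univ.filter (fun v => (f v).isSome = true)).card

/-- Alice has a winning strategy from position `f` when `n` vertices remain uncolored:
Alice wins exactly the plays in which the entire graph gets colored; as soon as some
uncolored vertex has no legal color, Bob wins. -/
def aliceWinsFrom {V C : Type} [Fintype V] [DecidableEq V] (G : SimpleGraph V) :
    ℕ → (V → Option C) → Prop
  | 0, f => isFull f
  | n + 1, f => isFull f ∨ (¬ isStuck G f ∧
      ((aliceTurn f ∧ ∃ f', gameMove G f f' ∧ aliceWinsFrom G n f') ∨
       (¬ aliceTurn f ∧ ∀ f', gameMove G f f' → aliceWinsFrom G n f')))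

/-- Alice has a winning strategy in the graph coloring game on `G` with `m` colors. -/
def aliceWins {V : Type} [Fintype V] [DecidableEq V] (G : SimpleGraph V) (m : ℕ) : Prop :=
  aliceWinsFrom (C := Fin m) G (Fintype.card V) (fun _ => none)

/-- The game chromatic number: the least number of colors for which Alice has
a winning strategy. -/
noncomputable def gameChromaticNumber {V : Type} [Fintype V] [DecidableEq V]
    (G : SimpleGraph V) : ℕ :=
  sInf {m | aliceWins G m}

/-- The complete multipartite graph `K_{r 0, …, r (k-1)}`. -/
def K (k : ℕ) (r : Fin k → ℕ) : SimpleGraph (Σ i : Fin k, Fin (r i)) :=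
  SimpleGraph.completeMultipartiteGraph (fun i => Fin (r i))

/-- The uncolored vertices of the part `i`. -/
def blanks {k : ℕ} {r : Fin k → ℕ} {C : Type} (f : (Σ i : Fin k, Fin (r i)) → Option C)
    (i : Fin k) : Finset (Fin (r i)) :=
  Finset.univ.filter (fun x => (f ⟨i, x⟩).isSome = false)

open Classical in
/-- The colors used on the part `i`. -/
noncomputable def usedColors {k : ℕ} {r : Fin k → ℕ} {C : Type} [Fintype C]
    (f : (Σ i : Fin k, Fin (r i)) → Option C) (i : Fin k) : Finset C :=
  Finset.univ.filter (fun c => ∃ x, f ⟨i, x⟩ = some c)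

/-- No two adjacent vertices share a color. -/
def IsProper {V C : Type} (G : SimpleGraph V) (f : V → Option C) : Prop :=
  ∀ v w c, G.Adj v w → f v = some c → f w ≠ some c

/-- The part `i` can be finished with `(r i + 1) / 2` colors, up to an excess of `e`,
if its remaining vertices are colored in pairs. -/
def WithinBudget {k : ℕ} {r : Fin k → ℕ} {C : Type} [Fintype C] (e : ℕ)
    (f : (Σ i : Fin k, Fin (r i)) → Option C) (i : Fin k) : Prop :=
  (usedColors f i).card + ((blanks f i).card + 1) / 2 ≤ (r i + 1) / 2 + e

/-- Either all parts are within budget, or at most one part, in which Bob has just broken a pair,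
exceeds it, and then by at most one. -/
def Repairable {k : ℕ} {r : Fin k → ℕ} {C : Type} [Fintype C]
    (f : (Σ i : Fin k, Fin (r i)) → Option C) : Prop :=
  (∀ i, WithinBudget 0 f i) ∨
    ∃ j, Odd (blanks f j).card ∧ (usedColors f j).Nonempty ∧ WithinBudget 1 f j ∧
      ∀ i, i ≠ j → WithinBudget 0 f i

section

variable {k : ℕ} {r : Fin k → ℕ} {C : Type}

theorem mem_usedColors [Fintype C] {f : (Σ i : Fin k, Fin (r i)) → Option C} {i : Fin k} {c : C} :
    c ∈ usedColors f i ↔ ∃ x, f ⟨i, x⟩ = some c := by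
  simp [usedColors]

theorem IsProper.update {V : Type} [DecidableEq V] {G : SimpleGraph V} {f : V → Option C}
    (hf : IsProper G f) {v : V} {c : C} (hc : legalColor G f v c) :
    IsProper G (Function.update f v (some c)) := by
  intro a b d hab ha hb
  by_cases hav : a = v
  · subst hav
    have hba : b ≠ a := hab.ne'
    simp only [Function.update_self, Function.update_of_ne hba, Option.some.injEq] at ha hb
    subst ha
    exact hc b hab hb
  · by_cases hbv : b = v
    · subst hbv
      simp only [Function.update_self, Function.update_of_ne hav, Option.some.injEq] at ha hb
      subst hb
      exact hc a hab.symm ha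
    · rw [Function.update_of_ne hav] at ha
      rw [Function.update_of_ne hbv] at hb
      exact hf a b d hab ha hb

theorem legalColor_of_mem_usedColors [Fintype C] {f : (Σ i : Fin k, Fin (r i)) → Option C}
    (hf : IsProper (K k r) f) {v : Σ i : Fin k, Fin (r i)} {c : C} (hc : c ∈ usedColors f v.1) :
    legalColor (K k r) f v c := by
  obtain ⟨x, hx⟩ := mem_usedColors.1 hc
  intro w hw
  exact hf ⟨v.1, x⟩ w c hw hx

theorem blanks_update_of_ne (f : (Σ i : Fin k, Fin (r i)) → Option C)
    {v : Σ i : Fin k, Fin (r i)} (c : C) {i : Fin k} (hi : i ≠ v.1) :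
    blanks (Function.update f v (some c)) i = blanks f i := by
  have h : ∀ x, (⟨i, x⟩ : Σ i : Fin k, Fin (r i)) ≠ v := fun x hx => hi (by rw [← hx])
  simp [blanks, Function.update_of_ne (h _)]

theorem usedColors_update_of_ne [Fintype C] (f : (Σ i : Fin k, Fin (r i)) → Option C)
    {v : Σ i : Fin k, Fin (r i)} (c : C) {i : Fin k} (hi : i ≠ v.1) :
    usedColors (Function.update f v (some c)) i = usedColors f i := by
  have h : ∀ x, (⟨i, x⟩ : Σ i : Fin k, Fin (r i)) ≠ v := fun x hx => hi (by rw [← hx])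
  ext d
  simp only [mem_usedColors, Function.update_of_ne (h _)]

theorem WithinBudget.update_of_ne [Fintype C] {e : ℕ} {f : (Σ i : Fin k, Fin (r i)) → Option C}
    {v : Σ i : Fin k, Fin (r i)} {c : C} {i : Fin k} (h : WithinBudget e f i) (hi : i ≠ v.1) :
    WithinBudget e (Function.update f v (some c)) i := by
  unfold WithinBudget
  rwa [usedColors_update_of_ne f c hi, blanks_update_of_ne f c hi]

theorem card_blanks_update (f : (Σ i : Fin k, Fin (r i)) → Option C)
    {v : Σ i : Fin k, Fin (r i)} (c : C) (hv : f v = none) :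
    (blanks (Function.update f v (some c)) v.1).card + 1 = (blanks f v.1).card := by
  obtain ⟨i, x⟩ := v
  have hx : x ∈ blanks f i := by simp [blanks, hv]
  rw [← Finset.card_erase_add_one hx]
  congr 2
  ext y
  by_cases hy : y = x
  · simp [blanks, hy]
  · simp [blanks, hy, Function.update_of_ne]

theorem usedColors_update_subset [Fintype C] [DecidableEq C]
    (f : (Σ i : Fin k, Fin (r i)) → Option C) (v : Σ i : Fin k, Fin (r i)) (c : C) :
    usedColors (Function.update f v (some c)) v.1 ⊆ insert c (usedColors f v.1) := by
  intro d hd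
  obtain ⟨y, hy⟩ := mem_usedColors.1 hd
  rw [Finset.mem_insert, mem_usedColors]
  by_cases h : (⟨v.1, y⟩ : Σ i : Fin k, Fin (r i)) = v
  · rw [h, Function.update_self] at hy
    exact Or.inl (Option.some.inj hy).symm
  · rw [Function.update_of_ne h] at hy
    exact Or.inr ⟨y, hy⟩

theorem card_usedColors_update_le [Fintype C] (f : (Σ i : Fin k, Fin (r i)) → Option C)
    (v : Σ i : Fin k, Fin (r i)) (c : C) :
    (usedColors (Function.update f v (some c)) v.1).card ≤ (usedColors f v.1).card + 1 := by
  classical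
  exact (Finset.card_le_card (usedColors_update_subset f v c)).trans (Finset.card_insert_le _ _)

theorem card_usedColors_update_le_of_mem [Fintype C] (f : (Σ i : Fin k, Fin (r i)) → Option C)
    {v : Σ i : Fin k, Fin (r i)} {c : C} (hc : c ∈ usedColors f v.1) :
    (usedColors (Function.update f v (some c)) v.1).card ≤ (usedColors f v.1).card := by
  classical
  have h := usedColors_update_subset f v c
  rw [Finset.insert_eq_of_mem hc] at h
  exact Finset.card_le_card h

theorem exists_blank_of_odd {f : (Σ i : Fin k, Fin (r i)) → Option C} {i : Fin k}
    (h : Odd (blanks f i).card) : ∃ x, f ⟨i, x⟩ = none := by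
  obtain ⟨x, hx⟩ := Finset.card_pos.1 h.pos
  exact ⟨x, by simpa [blanks] using hx⟩

theorem sum_card_blanks_update (f : (Σ i : Fin k, Fin (r i)) → Option C)
    {v : Σ i : Fin k, Fin (r i)} (c : C) (hv : f v = none) :
    ∑ i, (blanks (Function.update f v (some c)) i).card + 1 = ∑ i, (blanks f i).card := by
  rw [← Finset.add_sum_erase _ _ (Finset.mem_univ v.1),
    ← Finset.add_sum_erase _ (fun i => (blanks f i).card) (Finset.mem_univ v.1),
    ← card_blanks_update f c hv, Finset.sum_congr rfl fun i hi => by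
      rw [blanks_update_of_ne f c (Finset.ne_of_mem_erase hi)]]
  omega

theorem card_colored_add_sum_card_blanks (f : (Σ i : Fin k, Fin (r i)) → Option C) :
    (Finset.univ.filter (fun v => (f v).isSome = true)).card + ∑ i, (blanks f i).card =
      ∑ i, r i := by
  have h := Finset.card_filter_add_card_filter_not (s := Finset.univ)
    (fun v : Σ i : Fin k, Fin (r i) => (f v).isSome = true)
  have h2 : (Finset.univ.filter (fun v => ¬ (f v).isSome = true)).card
      = ∑ i, (blanks f i).card := by
    rw [← Finset.card_sigma]
    congr 1
    ext v
    simp [blanks]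
  rw [h2] at h
  simpa using h

theorem aliceTurn_iff (hodd : Odd (∑ i, r i)) (f : (Σ i : Fin k, Fin (r i)) → Option C) :
    aliceTurn f ↔ Odd (∑ i, (blanks f i).card) := by
  rw [← card_colored_add_sum_card_blanks f] at hodd
  unfold aliceTurn
  rw [Nat.odd_add] at hodd
  rw [← Nat.not_even_iff_odd, ← hodd, Nat.not_odd_iff_even]

theorem isFull_of_sum_card_blanks {f : (Σ i : Fin k, Fin (r i)) → Option C}
    (h : ∑ i, (blanks f i).card = 0) : isFull f := by
  rintro ⟨i, x⟩
  have hi : blanks f i = ∅ :=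
    Finset.card_eq_zero.1 (Finset.sum_eq_zero_iff.1 h i (Finset.mem_univ i))
  by_contra hx
  have : x ∈ blanks f i := by simpa [blanks] using hx
  simp [hi] at this

/-- If no part uses more than half of its size in colors, then every vertex has a legal color. -/
theorem exists_legalColor [Fintype C] (hpos : ∀ i, 1 ≤ r i)
    (hC : Fintype.card C = ∑ i, (r i + 1) / 2) {f : (Σ i : Fin k, Fin (r i)) → Option C}
    (hf : IsProper (K k r) f) (hcard : ∀ i, (usedColors f i).card ≤ (r i + 1) / 2)
    (v : Σ i : Fin k, Fin (r i)) : ∃ c, legalColor (K k r) f v c := by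
  classical
  rcases (usedColors f v.1).eq_empty_or_nonempty with h | ⟨c, hc⟩
  · have hlt : (Finset.univ.biUnion (usedColors f)).card < Fintype.card C := by
      rw [hC]
      refine Finset.card_biUnion_le.trans_lt
        (Finset.sum_lt_sum (fun i _ => hcard i) ⟨v.1, Finset.mem_univ _, ?_⟩)
      have := hpos v.1
      rw [h, Finset.card_empty]
      omega
    obtain ⟨c, hc⟩ : ∃ c, c ∉ Finset.univ.biUnion (usedColors f) := by
      by_contra! hall
      exact hlt.ne ((Finset.card_eq_iff_eq_univ _).2 (Finset.eq_univ_iff_forall.2 hall))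
    refine ⟨c, fun w _ hwc => hc ?_⟩
    exact Finset.mem_biUnion.2 ⟨w.1, Finset.mem_univ _, mem_usedColors.2 ⟨w.2, hwc⟩⟩
  · exact ⟨c, legalColor_of_mem_usedColors hf hc⟩

theorem Repairable.card_usedColors_le [Fintype C] {f : (Σ i : Fin k, Fin (r i)) → Option C}
    (h : Repairable f) (i : Fin k) : (usedColors f i).card ≤ (r i + 1) / 2 := by
  rcases h with h | ⟨j, hj, -, hj1, h⟩
  · have := h i
    unfold WithinBudget at this
    omega
  · by_cases hij : i = j
    · subst hij
      have := hj.pos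
      unfold WithinBudget at hj1
      omega
    · have := h i hij
      unfold WithinBudget at this
      omega

/-- Alice can bring every part back within budget. -/
theorem Repairable.exists_gameMove [Fintype C] (hpos : ∀ i, 1 ≤ r i)
    (hC : Fintype.card C = ∑ i, (r i + 1) / 2) {f : (Σ i : Fin k, Fin (r i)) → Option C}
    (hf : IsProper (K k r) f) (h : Repairable f) (hodd : Odd (∑ i, (blanks f i).card)) :
    ∃ v c, f v = none ∧ legalColor (K k r) f v c ∧
      ∀ i, WithinBudget 0 (Function.update f v (some c)) i := by
  have hcard := h.card_usedColors_le
  rcases h with h | ⟨j, hj, ⟨c, hc⟩, hj1, h⟩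
  · obtain ⟨j, hj⟩ : ∃ j, Odd (blanks f j).card := by
      by_contra! hall
      exact Nat.not_even_iff_odd.2 hodd
        (Finset.even_sum _ fun i _ => Nat.not_odd_iff_even.1 (hall i))
    obtain ⟨x, hx⟩ := exists_blank_of_odd hj
    obtain ⟨c, hc⟩ := exists_legalColor hpos hC hf hcard ⟨j, x⟩
    refine ⟨⟨j, x⟩, c, hx, hc, fun i => ?_⟩
    by_cases hij : i = j
    · subst hij
      have h1 := card_blanks_update f c hx
      have h2 := card_usedColors_update_le f ⟨i, x⟩ c
      have h3 := h i
      obtain ⟨t, ht⟩ := hj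
      unfold WithinBudget at h3 ⊢
      dsimp only at h1 h2
      omega
    · exact (h i).update_of_ne hij
  · obtain ⟨x, hx⟩ := exists_blank_of_odd hj
    refine ⟨⟨j, x⟩, c, hx, legalColor_of_mem_usedColors hf hc, fun i => ?_⟩
    by_cases hij : i = j
    · subst hij
      have h1 := card_blanks_update f c hx
      have h2 := card_usedColors_update_le_of_mem (v := ⟨i, x⟩) f hc
      obtain ⟨t, ht⟩ := hj
      unfold WithinBudget at hj1 ⊢
      dsimp only at h1 h2
      omega
    · exact (h i hij).update_of_ne hij

/-- Whatever Bob does, Alice can repair it. -/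
theorem repairable_update [Fintype C] {f : (Σ i : Fin k, Fin (r i)) → Option C}
    (h : ∀ i, WithinBudget 0 f i) {v : Σ i : Fin k, Fin (r i)} (c : C) (hv : f v = none) :
    Repairable (Function.update f v (some c)) := by
  have h1 := card_blanks_update f c hv
  have h2 := card_usedColors_update_le f v c
  have h3 := h v.1
  unfold WithinBudget at h3
  rcases Nat.even_or_odd (blanks f v.1).card with he | ho
  · refine Or.inr ⟨v.1, ?_, ⟨c, mem_usedColors.2 ⟨v.2, Function.update_self ..⟩⟩, ?_,
      fun i hi => (h i).update_of_ne hi⟩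
    · rw [← h1, Nat.even_add_one, Nat.not_even_iff_odd] at he
      exact he
    · unfold WithinBudget
      obtain ⟨t, ht⟩ := he
      omega
  · refine Or.inl fun i => ?_
    by_cases hi : i = v.1
    · subst hi
      unfold WithinBudget
      obtain ⟨t, ht⟩ := ho
      omega
    · exact (h i).update_of_ne hi

theorem aliceWinsFrom_of_invariant [Fintype C] (hpos : ∀ i, 1 ≤ r i) (hodd : Odd (∑ i, r i))
    (hC : Fintype.card C = ∑ i, (r i + 1) / 2) (n : ℕ)
    (f : (Σ i : Fin k, Fin (r i)) → Option C) (hn : ∑ i, (blanks f i).card = n)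
    (hf : IsProper (K k r) f) (hrep : Repairable f)
    (hbob : ¬ aliceTurn f → ∀ i, WithinBudget 0 f i) :
    aliceWinsFrom (K k r) n f := by
  induction n generalizing f with
  | zero => exact isFull_of_sum_card_blanks hn
  | succ n ih =>
    refine Or.inr ⟨?_, ?_⟩
    · rintro ⟨v, -, hv⟩
      obtain ⟨c, hc⟩ := exists_legalColor hpos hC hf hrep.card_usedColors_le v
      exact hv c hc
    · by_cases ht : aliceTurn f
      · obtain ⟨v, c, hv, hc, hb⟩ :=
          hrep.exists_gameMove hpos hC hf ((aliceTurn_iff hodd f).1 ht)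
        have hs := sum_card_blanks_update f c hv
        exact Or.inl ⟨ht, _, ⟨v, c, hv, hc, rfl⟩,
          ih _ (by omega) (hf.update hc) (Or.inl hb) fun _ => hb⟩
      · refine Or.inr ⟨ht, ?_⟩
        rintro _ ⟨v, c, hv, hc, rfl⟩
        have hs := sum_card_blanks_update f c hv
        refine ih _ (by omega) (hf.update hc) (repairable_update (hbob ht) c hv) fun ht' => ?_
        rw [aliceTurn_iff hodd, ← hs, Nat.odd_add_one, not_not] at ht
        exact absurd ((aliceTurn_iff hodd _).2 ht) ht'

end

theorem game_chromatic_le_of_odd (k : ℕ) (hk : 1 ≤ k) (r : Fin k → ℕ)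
    (hanti : Antitone r) (hpos : ∀ i, 1 ≤ r i) (hodd : Odd (∑ i, r i)) :
    gameChromaticNumber (K k r) ≤ ∑ i, (r i + 1) / 2 := by
  refine Nat.sInf_le ?_
  have hb : ∀ i, WithinBudget 0
      (fun _ => none : (Σ i : Fin k, Fin (r i)) → Option (Fin (∑ i, (r i + 1) / 2))) i := by
    simp [WithinBudget, usedColors, blanks]
  exact aliceWinsFrom_of_invariant hpos hodd (by simp) _ _ (by simp [blanks])
    (by simp [IsProper]) (Or.inl hb) fun _ => hb
end

section
/- For every complete multipartite graph K_{r_1,…,r_k} with r_k ≥ 4 (i.e. every part has at least 4 vertices), the game chromatic number satisfies χ_g(K_{r_1,…,r_k}) ≥ 2k − 1. -/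
section GeneralGraph

variable {V C : Type} [Fintype V] {G : SimpleGraph V} {f : V → Option C}

/-- With at least as many colors as vertices, every uncolored vertex has a legal color. -/
lemma exists_legalColor_of_card_le [Fintype C] (hC : Fintype.card V ≤ Fintype.card C) {v : V}
    (hv : f v = none) : ∃ c, legalColor G f v c := by
  classical
  by_contra! h
  have h' : ∀ c, ∃ w, f w = some c := by
    intro c
    have := h c
    unfold legalColor at this
    push Not at this
    obtain ⟨w, -, hw⟩ := this
    exact ⟨w, hw⟩
  choose g hg using h'
  have hinj : Function.Injective g := fun a b hab => by
    have := hg a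
    rw [hab, hg b] at this
    exact (Option.some.inj this).symm
  have hlt : Fintype.card C < Fintype.card V :=
    Fintype.card_lt_of_injective_of_notMem g hinj (b := v) (by
      rintro ⟨c, rfl⟩
      rw [hg c] at hv
      exact absurd hv (by simp))
  omega

variable [DecidableEq V]

lemma aliceTurn_update_iff {v : V} (hv : f v = none) (c : C) :
    aliceTurn (Function.update f v (some c)) ↔ ¬ aliceTurn f := by
  have h : (Finset.univ.filter fun w => (Function.update f v (some c) w).isSome = true) =
      insert v (Finset.univ.filter fun w => (f w).isSome = true) := by
    ext w
    by_cases hw : w = v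
    · subst hw; simp
    · simp [hw]
  unfold aliceTurn
  rw [h, Finset.card_insert_of_notMem (by simp [hv])]
  exact Nat.even_add_one

lemma aliceWinsFrom_of_card_le [Fintype C] (hC : Fintype.card V ≤ Fintype.card C) (n : ℕ)
    (f : V → Option C) (hn : (Finset.univ.filter fun v => f v = none).card ≤ n) :
    aliceWinsFrom G n f := by
  induction n generalizing f with
  | zero =>
    intro v
    by_contra h
    have : v ∈ Finset.univ.filter fun v => f v = none := by simpa using h
    rw [Finset.card_eq_zero.mp (Nat.le_zero.mp hn)] at this
    simp at this
  | succ n ih =>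
    have step : ∀ f', gameMove G f f' → aliceWinsFrom G n f' := by
      rintro f' ⟨v, c, hv, -, rfl⟩
      apply ih
      have h : (Finset.univ.filter fun w => Function.update f v (some c) w = none) =
          (Finset.univ.filter fun w => f w = none).erase v := by
        ext w
        by_cases hw : w = v
        · subst hw; simp
        · simp [hw]
      rw [h, Finset.card_erase_of_mem (by simp [hv])]
      omega
    by_cases hfull : isFull f
    · exact Or.inl hfull
    refine Or.inr ⟨?_, ?_⟩
    · rintro ⟨v, hv, hno⟩
      obtain ⟨c, hc⟩ := exists_legalColor_of_card_le (G := G) hC hv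
      exact hno c hc
    · by_cases ht : aliceTurn f
      · unfold isFull at hfull
        push Not at hfull
        obtain ⟨v, hv⟩ := hfull
        have hv : f v = none := by simpa using hv
        obtain ⟨c, hc⟩ := exists_legalColor_of_card_le (G := G) hC hv
        exact Or.inl ⟨ht, _, ⟨v, c, hv, hc, rfl⟩, step _ ⟨v, c, hv, hc, rfl⟩⟩
      · exact Or.inr ⟨ht, step⟩

lemma aliceWins_card (G : SimpleGraph V) : aliceWins G (Fintype.card V) :=
  aliceWinsFrom_of_card_le (by simp) _ _ (by simp)

end GeneralGraph

section Multipartite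

variable {k m : ℕ} {r : Fin k → ℕ}

/-- The colors that have not been used yet. -/
def freeColors (f : (Σ i : Fin k, Fin (r i)) → Option (Fin m)) : Finset (Fin m) :=
  Finset.univ.filter fun c => ∀ v, f v ≠ some c

/-- The parts without a colored vertex. -/
def untouchedParts (f : (Σ i : Fin k, Fin (r i)) → Option (Fin m)) : Finset (Fin k) :=
  Finset.univ.filter fun i => ∀ j, f ⟨i, j⟩ = none

/-- The uncolored vertices in parts that contain a colored vertex. -/
def openVertices (f : (Σ i : Fin k, Fin (r i)) → Option (Fin m)) :
    Finset (Σ i : Fin k, Fin (r i)) :=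
  Finset.univ.filter fun v => f v = none ∧ v.1 ∉ untouchedParts f

variable {f : (Σ i : Fin k, Fin (r i)) → Option (Fin m)} {v : Σ i : Fin k, Fin (r i)} {c : Fin m}

lemma mem_freeColors : c ∈ freeColors f ↔ ∀ v, f v ≠ some c := by simp [freeColors]

lemma mem_untouchedParts {i : Fin k} : i ∈ untouchedParts f ↔ ∀ j, f ⟨i, j⟩ = none := by
  simp [untouchedParts]

lemma mem_openVertices : v ∈ openVertices f ↔ f v = none ∧ v.1 ∉ untouchedParts f := by
  simp [openVertices]

lemma freeColors_update (hv : f v = none) :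
    freeColors (Function.update f v (some c)) = (freeColors f).erase c := by
  ext d
  simp only [mem_freeColors, Finset.mem_erase]
  constructor
  · intro h
    refine ⟨?_, fun w hw => ?_⟩
    · rintro rfl
      exact h v (by simp)
    · by_cases hwv : w = v
      · subst hwv; simp [hv] at hw
      · exact h w (by simpa [hwv] using hw)
  · rintro ⟨hdc, h⟩ w
    by_cases hwv : w = v
    · subst hwv; simpa using Ne.symm hdc
    · simpa [hwv] using h w

lemma untouchedParts_update :
    untouchedParts (Function.update f v (some c)) = (untouchedParts f).erase v.1 := by
  obtain ⟨a, b⟩ := v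
  ext i
  simp only [mem_untouchedParts, Finset.mem_erase]
  constructor
  · intro h
    have hi : i ≠ a := by
      rintro rfl
      simpa using h b
    refine ⟨hi, fun j => ?_⟩
    have := h j
    rwa [Function.update_of_ne (by intro e; exact hi (congrArg Sigma.fst e))] at this
  · rintro ⟨hi, h⟩ j
    rw [Function.update_of_ne (by intro e; exact hi (congrArg Sigma.fst e))]
    exact h j

lemma openVertices_update_of_touched (hv : v.1 ∉ untouchedParts f) :
    openVertices (Function.update f v (some c)) = (openVertices f).erase v := by
  ext w
  rw [Finset.mem_erase, mem_openVertices, mem_openVertices, untouchedParts_update,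
    Finset.erase_eq_of_notMem hv]
  by_cases hw : w = v
  · subst hw; simp
  · simp [hw]

lemma three_le_card_openVertices_update (h4 : ∀ i, 4 ≤ r i) (hv : v.1 ∈ untouchedParts f) :
    3 ≤ (openVertices (Function.update f v (some c))).card := by
  obtain ⟨a, b⟩ := v
  have hsub : ((Finset.univ.erase b).map (Function.Embedding.sigmaMk a)) ⊆
      openVertices (Function.update f ⟨a, b⟩ (some c)) := by
    intro w hw
    simp only [Finset.mem_map, Finset.mem_erase, Finset.mem_univ, and_true] at hw
    obtain ⟨j, hj, rfl⟩ := hw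
    rw [mem_openVertices, untouchedParts_update]
    refine ⟨?_, by simp⟩
    rw [Function.update_of_ne (by simpa using hj)]
    exact mem_untouchedParts.mp hv j
  have := Finset.card_le_card hsub
  rw [Finset.card_map, Finset.card_erase_of_mem (Finset.mem_univ b)] at this
  simp only [Finset.card_univ, Fintype.card_fin] at this
  have := h4 a
  omega

lemma legalColor_of_mem_freeColors (hc : c ∈ freeColors f) : legalColor (K k r) f v c :=
  fun w _ => mem_freeColors.mp hc w

lemma mem_freeColors_of_legalColor (hv : v.1 ∈ untouchedParts f)
    (hc : legalColor (K k r) f v c) : c ∈ freeColors f := by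
  rw [mem_freeColors]
  intro w hw
  refine hc w ?_ hw
  obtain ⟨a, b⟩ := v
  obtain ⟨i, j⟩ := w
  show a ≠ i
  rintro rfl
  rw [mem_untouchedParts.mp hv j] at hw
  exact absurd hw (by simp)

lemma isStuck_of_freeColors_eq_empty (h4 : ∀ i, 4 ≤ r i) (hu : (untouchedParts f).Nonempty)
    (hc : freeColors f = ∅) : isStuck (K k r) f := by
  obtain ⟨i, hi⟩ := hu
  refine ⟨⟨i, ⟨0, by have := h4 i; omega⟩⟩, mem_untouchedParts.mp hi _, fun c h => ?_⟩
  have := mem_freeColors_of_legalColor (c := c) hi h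
  simp [hc] at this

lemma not_isFull_of_untouchedParts_nonempty (h4 : ∀ i, 4 ≤ r i)
    (hu : (untouchedParts f).Nonempty) : ¬ isFull f := by
  obtain ⟨i, hi⟩ := hu
  intro h
  have := h ⟨i, ⟨0, by have := h4 i; omega⟩⟩
  simp [mem_untouchedParts.mp hi] at this

/-- The positions on Alice's turn that Bob maintains: at least two colors are missing for Alice to
touch all parts while Bob answers each time with a new color, and Alice cannot exhaust the
vertices in touched parts without giving Bob an additional color. -/
def bobAhead (f : (Σ i : Fin k, Fin (r i)) → Option (Fin m)) : Prop :=
  (freeColors f).card + 2 ≤ 2 * (untouchedParts f).card ∧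
    ((openVertices f).card = 1 → (freeColors f).card + 3 ≤ 2 * (untouchedParts f).card)

/-- The positions on Bob's turn from which Bob can return to `bobAhead`. -/
def bobCanReply (f : (Σ i : Fin k, Fin (r i)) → Option (Fin m)) : Prop :=
  (freeColors f).card + 1 ≤ 2 * (untouchedParts f).card ∧
    ((openVertices f).card = 0 → (freeColors f).card + 3 ≤ 2 * (untouchedParts f).card) ∧
    ((openVertices f).card = 2 → (freeColors f).card + 2 ≤ 2 * (untouchedParts f).card)

lemma bobAhead.bobCanReply_of_gameMove (h4 : ∀ i, 4 ≤ r i) (h : bobAhead f)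
    {f' : (Σ i : Fin k, Fin (r i)) → Option (Fin m)} (hmove : gameMove (K k r) f f') :
    bobCanReply f' := by
  obtain ⟨v, c, hv, hc, rfl⟩ := hmove
  obtain ⟨h1, h2⟩ := h
  by_cases hvu : v.1 ∈ untouchedParts f
  · have hO := three_le_card_openVertices_update (c := c) h4 hvu
    have hcf := mem_freeColors_of_legalColor hvu hc
    have hpos := Finset.card_pos.mpr ⟨c, hcf⟩
    have hpos' := Finset.card_pos.mpr ⟨_, hvu⟩
    unfold bobCanReply
    rw [freeColors_update hv, untouchedParts_update, Finset.card_erase_of_mem hcf,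
      Finset.card_erase_of_mem hvu]
    omega
  · have hvo : v ∈ openVertices f := mem_openVertices.mpr ⟨hv, hvu⟩
    have hle := Finset.card_erase_le (s := freeColors f) (a := c)
    have hpos := Finset.card_pos.mpr ⟨v, hvo⟩
    unfold bobCanReply
    rw [freeColors_update hv, untouchedParts_update, Finset.erase_eq_of_notMem hvu,
      openVertices_update_of_touched hvu, Finset.card_erase_of_mem hvo]
    omega

lemma bobCanReply.exists_gameMove (h4 : ∀ i, 4 ≤ r i) (h : bobCanReply f)
    (hstuck : ¬ isStuck (K k r) f) :
    ∃ v c, f v = none ∧ legalColor (K k r) f v c ∧ bobAhead (Function.update f v (some c)) := by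
  obtain ⟨h1, h2, h3⟩ := h
  have hu : (untouchedParts f).Nonempty := Finset.card_pos.mp (by omega)
  have hfree : (freeColors f).Nonempty := Finset.nonempty_iff_ne_empty.mpr fun he =>
    hstuck (isStuck_of_freeColors_eq_empty h4 hu he)
  obtain ⟨c, hc⟩ := hfree
  have hcpos := Finset.card_pos.mpr ⟨c, hc⟩
  rcases (openVertices f).eq_empty_or_nonempty with hO | ⟨v, hvo⟩
  · obtain ⟨i, hi⟩ := hu
    let v : Σ i : Fin k, Fin (r i) := ⟨i, ⟨0, by have := h4 i; omega⟩⟩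
    have hv : f v = none := mem_untouchedParts.mp hi _
    have hO' := three_le_card_openVertices_update (v := v) (c := c) h4 hi
    refine ⟨v, c, hv, legalColor_of_mem_freeColors hc, ?_⟩
    have := h2 (by simp [hO])
    unfold bobAhead
    rw [freeColors_update hv, untouchedParts_update, Finset.card_erase_of_mem hc,
      Finset.card_erase_of_mem (a := v.1) hi]
    omega
  · obtain ⟨hv, hvu⟩ := mem_openVertices.mp hvo
    refine ⟨v, c, hv, legalColor_of_mem_freeColors hc, ?_⟩
    unfold bobAhead
    rw [freeColors_update hv, untouchedParts_update, Finset.erase_eq_of_notMem hvu,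
      openVertices_update_of_touched hvu, Finset.card_erase_of_mem hc,
      Finset.card_erase_of_mem hvo]
    omega

lemma not_aliceWinsFrom (h4 : ∀ i, 4 ≤ r i) (n : ℕ)
    (f : (Σ i : Fin k, Fin (r i)) → Option (Fin m))
    (h : (aliceTurn f ∧ bobAhead f) ∨ (¬ aliceTurn f ∧ bobCanReply f)) :
    ¬ aliceWinsFrom (K k r) n f := by
  have hfull : ¬ isFull f := by
    apply not_isFull_of_untouchedParts_nonempty h4
    apply Finset.card_pos.mp
    rcases h with ⟨-, h⟩ | ⟨-, h⟩ <;> have := h.1 <;> omega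
  induction n generalizing f with
  | zero => exact hfull
  | succ n ih =>
    have next : ∀ f' : (Σ i : Fin k, Fin (r i)) → Option (Fin m),
        (aliceTurn f' ∧ bobAhead f') ∨ (¬ aliceTurn f' ∧ bobCanReply f') →
        ¬ aliceWinsFrom (K k r) n f' := by
      intro f' h'
      refine ih f' h' (not_isFull_of_untouchedParts_nonempty h4 (Finset.card_pos.mp ?_))
      rcases h' with ⟨-, h'⟩ | ⟨-, h'⟩ <;> have := h'.1 <;> omega
    rintro (hf | ⟨hstuck, ⟨ht, f', hmove, hwin⟩ | ⟨ht, hwin⟩⟩)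
    · exact hfull hf
    · have hb : bobAhead f := by tauto
      have hreply := hb.bobCanReply_of_gameMove h4 hmove
      obtain ⟨v, c, hv, -, rfl⟩ := hmove
      exact next _ (Or.inr ⟨by rw [aliceTurn_update_iff hv]; exact not_not.mpr ht, hreply⟩) hwin
    · have hb : bobCanReply f := by tauto
      obtain ⟨v, c, hv, hc, hahead⟩ := hb.exists_gameMove h4 hstuck
      exact next _ (Or.inl ⟨(aliceTurn_update_iff hv c).mpr ht, hahead⟩)
        (hwin _ ⟨v, c, hv, hc, rfl⟩)

end Multipartite

theorem game_chromatic_ge_of_parts_ge_four (k : ℕ) (hk : 1 ≤ k) (r : Fin k → ℕ)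
    (hanti : Antitone r) (h4 : ∀ i, 4 ≤ r i) :
    2 * k - 1 ≤ gameChromaticNumber (K k r) := by
  refine le_csInf ⟨_, aliceWins_card _⟩ fun m hm => ?_
  by_contra! hlt
  refine not_aliceWinsFrom (m := m) h4 _ _ (Or.inl ⟨by simp [aliceTurn], ?_⟩) hm
  have hO : openVertices (fun _ : Σ i : Fin k, Fin (r i) => (none : Option (Fin m))) = ∅ := by
    simp [openVertices, untouchedParts]
  have hF : freeColors (fun _ : Σ i : Fin k, Fin (r i) => (none : Option (Fin m))) =
      Finset.univ := by
    simp [freeColors]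
  have hU : untouchedParts (fun _ : Σ i : Fin k, Fin (r i) => (none : Option (Fin m))) =
      Finset.univ := by
    simp [untouchedParts]
  unfold bobAhead
  rw [hO, hF, hU, Finset.card_univ, Finset.card_univ, Fintype.card_fin, Fintype.card_fin,
    Finset.card_empty]
  omega
end
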